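/- arXiv:2410.06464 — 2 statements merged into one kernel-verified Lean document; each statement's English description precedes it below -/
import Mathlib

section
/- Let Σ be a topologically transitive one-sided Markov shift over the countable alphabet ℤ₊ and let A : Σ → ℝ be a locally Hölder continuous potential. Suppose that some non-empty compact σ-invariant subset of the Aubry set Ω(A) is contained in a Markov subshift over a finite subalphabet. Then for every ε > 0 there exists a locally Hölder continuous potential B : Σ → ℝ with ‖A − B‖_sv < ε such that B has at most one periodic probability measure as a maximizing measure with compact support (i.e. any B-maximizing σ-invariant probability measure with compact support equals a fixed periodic orbit measure). -/
open MeasureTheory Filter Set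
open scoped ENNReal

namespace CMS

/-- The one-sided Markov shift `Σ` over the countable alphabet `ℕ = ℤ₊`,
determined by the transition matrix `Tr`. -/
abbrev SS (Tr : ℕ → ℕ → Prop) : Type := {x : ℕ → ℕ // ∀ n, Tr (x n) (x (n + 1))}

/-- The left shift map `σ`. -/
def shiftMap (Tr : ℕ → ℕ → Prop) (x : SS Tr) : SS Tr :=
  ⟨fun n => x.1 (n + 1), fun n => x.2 (n + 1)⟩

open scoped Classical in
/-- The metric `d(x,y) = λ^ℓ`, `ℓ` the first index of disagreement (`0` if `x = y`). -/
noncomputable def sdist (lam : ℝ) {Tr : ℕ → ℕ → Prop} (x y : SS Tr) : ℝ :=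
  if h : ∃ n, x.1 n ≠ y.1 n then lam ^ Nat.find h else 0

/-- Birkhoff sum `S_n f`. -/
noncomputable def birk {Tr : ℕ → ℕ → Prop} (f : SS Tr → ℝ) (n : ℕ) (x : SS Tr) : ℝ :=
  ∑ i ∈ Finset.range n, f ((shiftMap Tr)^[i] x)

/-- `ℓ`-th variation of `f` restricted to a subset `s` (valued in `ℝ≥0∞`). -/
noncomputable def varAtOn (lam : ℝ) {Tr : ℕ → ℕ → Prop} (s : Set (SS Tr))
    (f : SS Tr → ℝ) (ℓ : ℕ) : ℝ≥0∞ :=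
  ⨆ (x ∈ s) (y ∈ s) (_ : sdist lam x y ≤ lam ^ ℓ), ENNReal.ofReal (f x - f y)

/-- `ℓ`-th variation `Var_ℓ(f)`. -/
noncomputable def varAt (lam : ℝ) {Tr : ℕ → ℕ → Prop} (f : SS Tr → ℝ) (ℓ : ℕ) : ℝ≥0∞ :=
  varAtOn lam Set.univ f ℓ

/-- `Var_k^∞(f) = ∑_{ℓ ≥ k} Var_ℓ(f)`. -/
noncomputable def varFrom (lam : ℝ) {Tr : ℕ → ℕ → Prop} (f : SS Tr → ℝ) (k : ℕ) : ℝ≥0∞ :=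
  ∑' ℓ : ℕ, varAt lam f (k + ℓ)

/-- `f` has summable variation: `Var_1^∞(f) < ∞`. -/
def SummableVar (lam : ℝ) {Tr : ℕ → ℕ → Prop} (f : SS Tr → ℝ) : Prop :=
  varFrom lam f 1 < ⊤

/-- `f` is locally Hölder continuous: `Var_ℓ(f) ≤ C λ^ℓ` for all `ℓ ≥ 1`. -/
def LocHolder (lam : ℝ) {Tr : ℕ → ℕ → Prop} (f : SS Tr → ℝ) : Prop :=
  ∃ C : ℝ, 0 < C ∧ ∀ ℓ : ℕ, 1 ≤ ℓ → varAt lam f ℓ ≤ ENNReal.ofReal (C * lam ^ ℓ)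

/-- `‖A - B‖_sv = Var_1^∞(A-B) + ‖A-B‖_∞`. -/
noncomputable def svDist (lam : ℝ) {Tr : ℕ → ℕ → Prop} (A B : SS Tr → ℝ) : ℝ≥0∞ :=
  varFrom lam (fun x => A x - B x) 1 + ⨆ x : SS Tr, ENNReal.ofReal |A x - B x|

/-- `A` is a potential: continuous and bounded from above. -/
def IsPotential {Tr : ℕ → ℕ → Prop} (A : SS Tr → ℝ) : Prop :=
  Continuous A ∧ BddAbove (Set.range A)

/-- Topological transitivity of the shift. -/
def TopTransitive (Tr : ℕ → ℕ → Prop) : Prop :=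
  ∀ U V : Set (SS Tr), IsOpen U → IsOpen V → U.Nonempty → V.Nonempty →
    ∃ n : ℕ, ((shiftMap Tr)^[n] '' U ∩ V).Nonempty

/-- The ergodic maximizing constant `β_A`. -/
noncomputable def beta {Tr : ℕ → ℕ → Prop} (A : SS Tr → ℝ) : ℝ :=
  sSup {r : ℝ | ∃ μ : Measure (SS Tr), IsProbabilityMeasure μ ∧
    μ.map (shiftMap Tr) = μ ∧ r = ∫ x, A x ∂μ}

/-- `μ` is an `A`-maximizing (shift-invariant Borel probability) measure. -/
def Maximizing {Tr : ℕ → ℕ → Prop} (A : SS Tr → ℝ) (μ : Measure (SS Tr)) : Prop :=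
  IsProbabilityMeasure μ ∧ μ.map (shiftMap Tr) = μ ∧ ∫ x, A x ∂μ = beta A

/-- Topological support of a measure. -/
def msupport {Tr : ℕ → ℕ → Prop} (μ : Measure (SS Tr)) : Set (SS Tr) :=
  {x | ∀ U : Set (SS Tr), IsOpen U → x ∈ U → 0 < μ U}

/-- `μ` is the uniform probability measure on a periodic orbit. -/
def PeriodicOrbitMeasure {Tr : ℕ → ℕ → Prop} (μ : Measure (SS Tr)) : Prop :=
  ∃ (y : SS Tr) (p : ℕ), 1 ≤ p ∧ (shiftMap Tr)^[p] y = y ∧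
    μ = (p : ℝ≥0∞)⁻¹ • ∑ i ∈ Finset.range p, Measure.dirac ((shiftMap Tr)^[i] y)

/-- `A` is coercive: `lim_{i→∞} sup A|_[i] = -∞`. -/
def Coercive {Tr : ℕ → ℕ → Prop} (A : SS Tr → ℝ) : Prop :=
  ∀ M : ℝ, ∃ N : ℕ, ∀ i : ℕ, N ≤ i → ∀ x : SS Tr, x.1 0 = i → A x ≤ M

/-- The Aubry set `Ω(A)`. -/
def Aubry (lam : ℝ) {Tr : ℕ → ℕ → Prop} (A : SS Tr → ℝ) : Set (SS Tr) :=
  {x | ∀ ε : ℝ, 0 < ε → ∃ (w : SS Tr) (n : ℕ), 0 < n ∧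
    sdist lam x w < ε ∧ sdist lam ((shiftMap Tr)^[n] w) x < ε ∧
    -ε < (n : ℝ) * beta A - birk A n w ∧ (n : ℝ) * beta A - birk A n w < ε}

/-- The auxiliary function `𝔖^k_l(x,y)` at level `γ`. -/
noncomputable def aux (lam : ℝ) {Tr : ℕ → ℕ → Prop} (A : SS Tr → ℝ) (γ : ℝ)
    (k l : ℕ) (x y : SS Tr) : EReal :=
  ⨅ (n : ℕ) (_ : l ≤ n) (w : SS Tr)
    (_ : sdist lam x w ≤ lam ^ k) (_ : sdist lam ((shiftMap Tr)^[n] w) y ≤ lam ^ k),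
    (((n : ℝ) * γ - birk A n w : ℝ) : EReal)

/-- The Mañé potential `φ^γ_A(x,y)`. -/
noncomputable def mane (lam : ℝ) {Tr : ℕ → ℕ → Prop} (A : SS Tr → ℝ) (γ : ℝ)
    (x y : SS Tr) : EReal :=
  ⨆ k : ℕ, aux lam A γ k 1 x y

/-- The Peierls barrier `h^γ_A(x,y)`. -/
noncomputable def peierls (lam : ℝ) {Tr : ℕ → ℕ → Prop} (A : SS Tr → ℝ) (γ : ℝ)
    (x y : SS Tr) : EReal :=
  ⨆ (k : ℕ) (l : ℕ), aux lam A γ k (l + 1) x y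

section

variable {Tr : ℕ → ℕ → Prop} {lam : ℝ}

/-- `x` and `y` share their first `k` symbols. -/
def Agree (k : ℕ) (x y : SS Tr) : Prop := ∀ i < k, x.1 i = y.1 i

lemma iterate_shiftMap_apply (n : ℕ) (x : SS Tr) (i : ℕ) :
    ((shiftMap Tr)^[n] x).1 i = x.1 (n + i) := by
  induction n generalizing x with
  | zero => simp
  | succ n ih =>
    rw [Function.iterate_succ_apply, ih]
    change x.1 (n + i + 1) = _
    rw [show n + i + 1 = n + 1 + i by omega]

lemma Agree.symm {k : ℕ} {x y : SS Tr} (h : Agree k x y) : Agree k y x :=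
  fun i hi => (h i hi).symm

lemma Agree.trans {k : ℕ} {x y z : SS Tr} (h : Agree k x y) (h' : Agree k y z) :
    Agree k x z := fun i hi => (h i hi).trans (h' i hi)

lemma Agree.mono {k l : ℕ} {x y : SS Tr} (h : Agree k x y) (hl : l ≤ k) : Agree l x y :=
  fun i hi => h i (hi.trans_le hl)

lemma Agree.iterate {n k : ℕ} {x y : SS Tr} (h : Agree (n + k) x y) :
    Agree k ((shiftMap Tr)^[n] x) ((shiftMap Tr)^[n] y) := fun i hi => by
  rw [iterate_shiftMap_apply, iterate_shiftMap_apply]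
  exact h _ (by omega)

lemma Agree.shift {k : ℕ} {x y : SS Tr} (h : Agree (k + 1) x y) :
    Agree k (shiftMap Tr x) (shiftMap Tr y) := fun i hi => h (i + 1) (by omega)

lemma sdist_le_pow_iff (h0 : 0 < lam) (h1 : lam < 1) {x y : SS Tr} {k : ℕ} :
    sdist lam x y ≤ lam ^ k ↔ Agree k x y := by
  classical
  unfold sdist
  split_ifs with h
  · rw [pow_le_pow_iff_right_of_lt_one₀ h0 h1]
    constructor
    · intro hk i hi
      by_contra hne
      exact absurd (Nat.find_min' h hne) (by omega)
    · intro hk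
      by_contra! hlt
      exact Nat.find_spec h (hk _ hlt)
  · push Not at h
    exact ⟨fun _ i _ => h i, fun _ => by positivity⟩

lemma birk_add (f : SS Tr → ℝ) (m n : ℕ) (x : SS Tr) :
    birk f (m + n) x = birk f m x + birk f n ((shiftMap Tr)^[m] x) := by
  simp only [birk, Finset.sum_range_add, ← Function.iterate_add_apply]
  congr 1
  exact Finset.sum_congr rfl fun i _ => by rw [add_comm]

lemma birk_one (f : SS Tr → ℝ) (x : SS Tr) : birk f 1 x = f x := by simp [birk]

lemma birk_zero (f : SS Tr → ℝ) (x : SS Tr) : birk f 0 x = 0 := by simp [birk]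

lemma birk_nonneg {f : SS Tr → ℝ} (hf : ∀ x, 0 ≤ f x) (n : ℕ) (x : SS Tr) : 0 ≤ birk f n x :=
  Finset.sum_nonneg fun _ _ => hf _

lemma exists_splice (n : ℕ) (w y : SS Tr) (h : w.1 n = y.1 0) :
    ∃ u : SS Tr, (shiftMap Tr)^[n] u = y ∧ u.1 0 = w.1 0 ∧
      ∀ k, Agree k ((shiftMap Tr)^[n] w) y → Agree (n + k) w u := by
  have hu : ∀ i, Tr (if i < n then w.1 i else y.1 (i - n))
      (if i + 1 < n then w.1 (i + 1) else y.1 (i + 1 - n)) := by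
    intro i
    rcases lt_trichotomy (i + 1) n with hi | hi | hi
    · rw [if_pos (by omega), if_pos hi]; exact w.2 i
    · rw [if_pos (by omega), if_neg (by omega), show i + 1 - n = 0 by omega, ← h, ← hi]
      exact w.2 i
    · rw [if_neg (by omega), if_neg (by omega), show i + 1 - n = i - n + 1 by omega]
      exact y.2 _
  refine ⟨⟨fun i => if i < n then w.1 i else y.1 (i - n), hu⟩, ?_, ?_, ?_⟩
  · ext i
    rw [iterate_shiftMap_apply]
    simp
  · rcases Nat.eq_zero_or_pos n with rfl | hn
    · simpa using h.symm
    · simp [hn]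
  · intro k hk i hi
    change w.1 i = if i < n then w.1 i else y.1 (i - n)
    split_ifs with hin
    · rfl
    · have := hk (i - n) (by omega)
      rwa [iterate_shiftMap_apply, show n + (i - n) = i by omega] at this

lemma exists_periodize {n : ℕ} (hn : 0 < n) (w : SS Tr) (h : w.1 n = w.1 0) :
    ∃ q : SS Tr, (shiftMap Tr)^[n] q = q ∧
      ∀ k, Agree k ((shiftMap Tr)^[n] w) w → Agree (n + k) q w := by
  have hq : ∀ i, Tr (w.1 (i % n)) (w.1 ((i + 1) % n)) := by
    intro i
    have h2 := w.2 (i % n)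
    have h3 := Nat.mod_lt i hn
    rcases Nat.lt_or_ge (i % n + 1) n with hi | hi
    · rwa [Nat.add_mod_eq_sub, if_pos, Nat.sub_zero, Nat.mod_eq_of_lt (by omega : 1 < n)]
      rw [Nat.mod_eq_of_lt (by omega : 1 < n)]
      exact hi
    · have h4 : i % n + 1 = n := by omega
      have : (i + 1) % n = 0 := by
        rw [Nat.add_mod, ← Nat.add_mod_mod, Nat.mod_mod, Nat.add_mod_mod, h4, Nat.mod_self]
      rw [this, ← h, ← h4]
      simpa [h4] using h2
  refine ⟨⟨fun i => w.1 (i % n), hq⟩, ?_, ?_⟩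
  · ext i
    rw [iterate_shiftMap_apply]
    simp
  · intro k hk i
    change i < n + k → w.1 (i % n) = w.1 i
    induction i using Nat.strong_induction_on with
    | _ i ih =>
      intro hi
      rcases Nat.lt_or_ge i n with hin | hin
      · rw [Nat.mod_eq_of_lt hin]
      · have := hk (i - n) (by omega)
        rw [iterate_shiftMap_apply, show n + (i - n) = i by omega] at this
        rw [this, ← ih (i - n) (by omega) (by omega), Nat.mod_eq_sub_mod hin]

lemma sum_range_iterate_of_periodic {M : Type*} [AddCommMonoid M] (F : SS Tr → M) {p : ℕ}
    (hp : 1 ≤ p) {y : SS Tr} (hy : (shiftMap Tr)^[p] y = y) (s : ℕ) :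
    ∑ i ∈ Finset.range p, F ((shiftMap Tr)^[i] ((shiftMap Tr)^[s] y)) =
      ∑ i ∈ Finset.range p, F ((shiftMap Tr)^[i] y) := by
  obtain ⟨q, rfl⟩ : ∃ q, p = q + 1 := ⟨p - 1, by omega⟩
  induction s with
  | zero => rfl
  | succ s ih =>
    rw [← ih, Finset.sum_range_succ, Finset.sum_range_succ']
    have h1 : (shiftMap Tr)^[q] ((shiftMap Tr)^[s + 1] y) = (shiftMap Tr)^[s] y := by
      rw [← Function.iterate_add_apply, show q + (s + 1) = s + (q + 1) by omega,
        Function.iterate_add_apply, hy]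
    rw [h1]
    congr 1
    refine Finset.sum_congr rfl fun i _ => ?_
    rw [← Function.iterate_add_apply, ← Function.iterate_add_apply]
    congr 2; omega

/-- On points sharing `k ≥ 1` symbols, `f` oscillates by at most `D * lam ^ k`. -/
def HolderBound (lam : ℝ) (f : SS Tr → ℝ) (D : ℝ) : Prop :=
  ∀ k x y, 1 ≤ k → Agree k x y → f x - f y ≤ D * lam ^ k

lemma isOpen_agree (k : ℕ) (y : SS Tr) : IsOpen {z : SS Tr | Agree k z y} := by
  have : {z : SS Tr | Agree k z y} = ⋂ i ∈ Finset.range k, {z : SS Tr | z.1 i = y.1 i} := by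
    ext z; simp [Agree]
  rw [this]
  refine isOpen_biInter_finset fun i _ => ?_
  have hc : Continuous fun z : SS Tr => z.1 i := (continuous_apply i).comp continuous_subtype_val
  exact (isOpen_discrete {y.1 i}).preimage hc

lemma HolderBound.continuous {f : SS Tr → ℝ} {D : ℝ} (h0 : 0 < lam) (h1 : lam < 1)
    (hf : HolderBound lam f D) : Continuous f := by
  rw [continuous_iff_continuousAt]
  intro y
  rw [Metric.continuousAt_iff']
  intro e he
  have ht : Tendsto (fun k => D * lam ^ k) atTop (nhds 0) := by
    simpa using (tendsto_pow_atTop_nhds_zero_of_lt_one h0.le h1).const_mul D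
  obtain ⟨k, hk, hk1⟩ := ((ht.eventually_lt_const he).and (eventually_ge_atTop 1)).exists
  filter_upwards [(isOpen_agree k y).mem_nhds (fun i _ => rfl : Agree k y y)] with z hz
  rw [Real.dist_eq, abs_lt]
  have := hf k z y hk1 hz
  have := hf k y z hk1 hz.symm
  constructor <;> linarith

lemma continuous_shiftMap : Continuous (shiftMap Tr) := by
  refine Continuous.subtype_mk (continuous_pi fun n => ?_) _
  exact (continuous_apply (n + 1)).comp continuous_subtype_val

lemma exists_word (htr : TopTransitive Tr) (x y : SS Tr) :
    ∃ (n : ℕ) (z : SS Tr), z.1 0 = x.1 0 ∧ z.1 n = y.1 0 := by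
  obtain ⟨n, _, ⟨z, hz, rfl⟩, hz'⟩ := htr _ _ (isOpen_agree 1 x) (isOpen_agree 1 y)
    ⟨x, fun i _ => rfl⟩ ⟨y, fun i _ => rfl⟩
  refine ⟨n, z, hz 0 one_pos, ?_⟩
  have := hz' 0 one_pos
  rwa [iterate_shiftMap_apply] at this

/-- The uniform measure on the orbit of `y` up to time `p`. -/
noncomputable def orbitMeasure (p : ℕ) (y : SS Tr) : Measure (SS Tr) :=
  (p : ℝ≥0∞)⁻¹ • ∑ i ∈ Finset.range p, Measure.dirac ((shiftMap Tr)^[i] y)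

lemma orbitMeasure_apply (p : ℕ) (y : SS Tr) {s : Set (SS Tr)} (hs : MeasurableSet s) :
    orbitMeasure p y s =
      (p : ℝ≥0∞)⁻¹ * ∑ i ∈ Finset.range p, s.indicator 1 ((shiftMap Tr)^[i] y) := by
  simp [orbitMeasure, Measure.finsetSum_apply, Measure.dirac_apply' _ hs]

lemma isProbabilityMeasure_orbitMeasure {p : ℕ} (hp : 1 ≤ p) (y : SS Tr) :
    IsProbabilityMeasure (orbitMeasure p y) := by
  constructor
  rw [orbitMeasure_apply _ _ MeasurableSet.univ]
  simp only [indicator_univ, Pi.one_apply, Finset.sum_const, Finset.card_range, nsmul_eq_mul,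
    mul_one]
  exact ENNReal.inv_mul_cancel (by simp; omega) (by simp)

lemma map_orbitMeasure {p : ℕ} (hp : 1 ≤ p) {y : SS Tr} (hy : (shiftMap Tr)^[p] y = y) :
    (orbitMeasure p y).map (shiftMap Tr) = orbitMeasure p y := by
  ext s hs
  rw [Measure.map_apply continuous_shiftMap.measurable hs, orbitMeasure_apply _ _ hs,
    orbitMeasure_apply _ _ (continuous_shiftMap.measurable hs),
    ← sum_range_iterate_of_periodic (s.indicator (1 : SS Tr → ℝ≥0∞)) hp hy 1]
  congr 1
  refine Finset.sum_congr rfl fun i _ => ?_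
  rw [← Function.iterate_add_apply, Function.iterate_succ_apply', indicator, indicator]
  rfl

lemma integral_orbitMeasure (f : SS Tr → ℝ) (p : ℕ) (y : SS Tr) :
    ∫ x, f x ∂(orbitMeasure p y) = (p : ℝ)⁻¹ * birk f p y := by
  rw [orbitMeasure, integral_smul_measure, integral_finsetSum_measure]
  · simp [birk]
  · exact fun i _ => integrable_dirac (by simp)

lemma bddAbove_integrals {f : SS Tr → ℝ} (hf : BddAbove (range f)) :
    BddAbove {r : ℝ | ∃ μ : Measure (SS Tr), IsProbabilityMeasure μ ∧
      μ.map (shiftMap Tr) = μ ∧ r = ∫ x, f x ∂μ} := by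
  obtain ⟨M, hM⟩ := hf
  refine ⟨max M 0, ?_⟩
  rintro r ⟨μ, hμ, -, rfl⟩
  by_cases hi : Integrable f μ
  · refine le_max_of_le_left ?_
    have := integral_mono hi (integrable_const M) fun x => hM (mem_range_self x)
    simpa using this
  · rw [integral_undef hi]; exact le_max_right _ _

lemma inv_mul_birk_le_beta {f : SS Tr → ℝ} (hf : BddAbove (range f)) {p : ℕ} (hp : 1 ≤ p)
    {y : SS Tr} (hy : (shiftMap Tr)^[p] y = y) : (p : ℝ)⁻¹ * birk f p y ≤ beta f :=
  le_csSup (bddAbove_integrals hf)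
    ⟨_, isProbabilityMeasure_orbitMeasure hp y, map_orbitMeasure hp hy,
      (integral_orbitMeasure f p y).symm⟩

lemma birk_le_mul_beta {f : SS Tr → ℝ} (hf : BddAbove (range f)) {p : ℕ} (hp : 1 ≤ p)
    {y : SS Tr} (hy : (shiftMap Tr)^[p] y = y) : birk f p y ≤ p * beta f := by
  have := inv_mul_birk_le_beta hf hp hy
  have hp' : (0 : ℝ) < p := by exact_mod_cast hp
  rwa [inv_mul_le_iff₀ hp'] at this

lemma birk_sub_le {f : SS Tr → ℝ} {C : ℝ} (h0 : 0 < lam) (h1 : lam < 1) (hC : 0 < C)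
    (hf : HolderBound lam f C) (n m : ℕ) {x y : SS Tr}
    (h : Agree (n + m) x y) : birk f n x - birk f n y ≤ C / (1 - lam) * lam ^ m := by
  have hl : 0 < 1 - lam := by linarith
  have key : birk f n x - birk f n y ≤ C / (1 - lam) * lam ^ m * (1 - lam ^ n) := by
    induction n generalizing x y with
    | zero => simp [birk_zero]
    | succ n ih =>
      rw [add_comm n 1, birk_add, birk_add, birk_one, birk_one]
      have h2 := ih (x := (shiftMap Tr)^[1] x) (y := (shiftMap Tr)^[1] y)
        (Agree.iterate (h.mono (by omega)))
      have h3 := hf _ x y (by omega) h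
      have h4 : C * lam ^ (n + 1 + m) ≤ C * (lam ^ m * lam ^ n) := by
        rw [← pow_add]
        exact mul_le_mul_of_nonneg_left (pow_le_pow_of_le_one h0.le h1.le (by omega)) hC.le
      have h5 : C / (1 - lam) * lam ^ m * (1 - lam ^ (1 + n)) =
          C / (1 - lam) * lam ^ m * (1 - lam ^ n) + C * (lam ^ m * lam ^ n) := by
        field_simp
        ring
      linarith
  refine key.trans (mul_le_of_le_one_right (by positivity) ?_)
  have : 0 ≤ lam ^ n := by positivity
  linarith

lemma varAt_le_iff (h0 : 0 < lam) (h1 : lam < 1) {f : SS Tr → ℝ} {k : ℕ} {c : ℝ} (hc : 0 ≤ c) :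
    varAt lam f k ≤ ENNReal.ofReal c ↔ ∀ x y, Agree k x y → f x - f y ≤ c := by
  simp only [varAt, varAtOn, iSup_le_iff, mem_univ, true_implies, sdist_le_pow_iff h0 h1,
    ENNReal.ofReal_le_ofReal_iff hc]

lemma LocHolder.exists_holderBound (h0 : 0 < lam) (h1 : lam < 1) {f : SS Tr → ℝ}
    (hf : LocHolder lam f) : ∃ C, 0 < C ∧ HolderBound lam f C := by
  obtain ⟨C, hC, h⟩ := hf
  exact ⟨C, hC, fun k x y hk hxy => (varAt_le_iff h0 h1 (by positivity)).1 (h k hk) x y hxy⟩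

lemma HolderBound.locHolder (h0 : 0 < lam) (h1 : lam < 1) {f : SS Tr → ℝ} {C : ℝ} (hC : 0 < C)
    (hf : HolderBound lam f C) : LocHolder lam f :=
  ⟨C, hC, fun k hk => (varAt_le_iff h0 h1 (by positivity)).2 fun x y hxy => hf k x y hk hxy⟩

/-- A transitive shift carries a locally Hölder sub-action. -/
lemma exists_subaction (h0 : 0 < lam) (h1 : lam < 1) (htr : TopTransitive Tr) {A : SS Tr → ℝ}
    (hA : BddAbove (range A)) {C : ℝ} (hC : 0 < C) (hAC : HolderBound lam A C) (o : SS Tr) :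
    ∃ h : SS Tr → ℝ, (∀ y, h y + A y - beta A ≤ h (shiftMap Tr y)) ∧
      HolderBound lam h (C / (1 - lam)) := by
  set D := C / (1 - lam) with hD
  let S : SS Tr → Set ℝ := fun y => {r | ∃ (n : ℕ) (w : SS Tr), w.1 0 = o.1 0 ∧
    (shiftMap Tr)^[n] w = y ∧ r = birk A n w - n * beta A}
  have hne : ∀ y, (S y).Nonempty := by
    intro y
    obtain ⟨n, z, hz, hzy⟩ := exists_word htr o y
    obtain ⟨u, hu, hu0, -⟩ := exists_splice n z y hzy
    exact ⟨_, n, u, hu0.trans hz, hu, rfl⟩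
  have hbdd : ∀ y, BddAbove (S y) := by
    intro y
    obtain ⟨m, z, hz, hzo⟩ := exists_word htr y o
    refine ⟨max 0 (2 * (D * lam) + m * beta A - birk A m z), ?_⟩
    rintro r ⟨n, w, hw, rfl, rfl⟩
    rcases Nat.eq_zero_or_pos (n + m) with h | hnm
    · obtain ⟨rfl, rfl⟩ : n = 0 ∧ m = 0 := by omega
      simp [birk_zero]
    refine le_max_of_le_right ?_
    rw [iterate_shiftMap_apply] at hz
    obtain ⟨u, hu, hu0, huk⟩ := exists_splice n w z hz.symm
    have e1 := birk_sub_le h0 h1 hC hAC n 1 (huk 1 fun i hi => by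
      obtain rfl : i = 0 := by omega
      rw [iterate_shiftMap_apply]; exact hz.symm)
    have hun : u.1 (n + m) = u.1 0 := by
      rw [← iterate_shiftMap_apply, hu, hzo, hu0, hw]
    obtain ⟨q, hq, hqk⟩ := exists_periodize hnm u hun
    have e2 := birk_sub_le h0 h1 hC hAC (n + m) 1 (hqk 1 fun i hi => by
      obtain rfl : i = 0 := by omega
      rw [iterate_shiftMap_apply]; exact hun).symm
    have e3 := birk_le_mul_beta hA hnm hq
    rw [birk_add A n m u, hu] at e2
    push_cast at e3
    rw [pow_one, ← hD] at e1 e2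
    linarith
  refine ⟨fun y => sSup (S y), fun y => ?_, fun k y y' hk hyy => ?_⟩
  · have : sSup (S y) ≤ sSup (S (shiftMap Tr y)) - A y + beta A := by
      refine csSup_le (hne y) ?_
      rintro r ⟨n, w, hw, rfl, rfl⟩
      have := le_csSup (hbdd (shiftMap Tr ((shiftMap Tr)^[n] w)))
        ⟨n + 1, w, hw, Function.iterate_succ_apply' _ _ _, rfl⟩
      rw [birk_add, birk_one] at this
      push_cast at this
      linarith
    linarith
  · have : sSup (S y) ≤ sSup (S y') + D * lam ^ k := by
      refine csSup_le (hne y) ?_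
      rintro r ⟨n, w, hw, rfl, rfl⟩
      have hwn := hyy 0 hk
      rw [iterate_shiftMap_apply] at hwn
      obtain ⟨u, hu, hu0, huk⟩ := exists_splice n w y' hwn
      have e1 := birk_sub_le h0 h1 hC hAC n k (huk k hyy)
      have := le_csSup (hbdd y') ⟨n, u, hu0.trans hw, hu, rfl⟩
      linarith
    linarith

/-- The normalized defect `β - A + h ∘ σ - h`. -/
def defect (A h : SS Tr → ℝ) (b : ℝ) (y : SS Tr) : ℝ := b - A y + h (shiftMap Tr y) - h y

lemma birk_defect (A h : SS Tr → ℝ) (b : ℝ) (n : ℕ) (y : SS Tr) :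
    birk (defect A h b) n y = n * b - birk A n y + h ((shiftMap Tr)^[n] y) - h y := by
  induction n with
  | zero => simp [birk_zero]
  | succ n ih =>
    rw [birk_add, birk_add, ih, birk_one, birk_one, defect, Function.iterate_succ_apply']
    push_cast
    ring

lemma birk_defect_sub_le {A h : SS Tr → ℝ} {C : ℝ} (h0 : 0 < lam) (h1 : lam < 1) (hC : 0 < C)
    (hAC : HolderBound lam A C) (hh : HolderBound lam h (C / (1 - lam))) (b : ℝ) {n m : ℕ}
    (hm : 1 ≤ m) {x y : SS Tr} (hxy : Agree (n + m) x y) :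
    birk (defect A h b) n x - birk (defect A h b) n y ≤ 3 * (C / (1 - lam) * lam ^ m) := by
  have hl : 0 < 1 - lam := by linarith
  rw [birk_defect, birk_defect]
  have e1 := birk_sub_le h0 h1 hC hAC n m hxy.symm
  have e2 := hh _ _ _ hm hxy.iterate
  have e3 := hh _ _ _ hm (hxy.mono (by omega : m ≤ n + m)).symm
  linarith

lemma defect_eq_zero_of_mem_aubry {A h : SS Tr → ℝ} {C : ℝ} (h0 : 0 < lam) (h1 : lam < 1)
    (hC : 0 < C) (hAC : HolderBound lam A C) (hh : HolderBound lam h (C / (1 - lam)))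
    (hR : ∀ y, 0 ≤ defect A h (beta A) y) {x : SS Tr} (hx : x ∈ Aubry lam A) :
    defect A h (beta A) x = 0 := by
  refine le_antisymm ?_ (hR x)
  set D := C / (1 - lam) with hD
  have hD0 : 0 < D := div_pos hC (by linarith)
  have key : ∀ k : ℕ, defect A h (beta A) x ≤ (lam + 2 * D * lam + 3 * D) * lam ^ k := by
    intro k
    obtain ⟨w, n, hn, hxw, hwx, -, hs⟩ := hx (lam ^ (k + 1 + 1)) (by positivity)
    obtain ⟨n', rfl⟩ : ∃ n', n = n' + 1 := ⟨n - 1, by omega⟩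
    have a1 := (sdist_le_pow_iff h0 h1).1 hxw.le
    have a2 := (sdist_le_pow_iff h0 h1).1 hwx.le
    have e1 := birk_defect A h (beta A) (n' + 1) w
    have e2 := hh _ _ _ (by omega) a2
    have e3 := hh _ _ _ (by omega) a1
    rw [add_comm n' 1, birk_add, birk_one, add_comm 1 n'] at e1
    have e4 := birk_nonneg hR n' ((shiftMap Tr)^[1] w)
    have e5 := birk_defect_sub_le h0 h1 hC hAC hh (beta A) (n := 1) (m := k + 1) (by omega)
      (a1.mono (by omega))
    rw [birk_one, birk_one] at e5
    rw [← hD] at e5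
    have p1 : lam ^ (k + 1) ≤ lam ^ k := pow_le_pow_of_le_one h0.le h1.le (by omega)
    have p2 : lam ^ (k + 1 + 1) ≤ lam ^ (k + 1) := pow_le_pow_of_le_one h0.le h1.le (by omega)
    have p3 := mul_le_mul_of_nonneg_left p1 hD0.le
    have p4 := mul_le_mul_of_nonneg_left p2 hD0.le
    have p5 : lam ^ (k + 1) = lam * lam ^ k := pow_succ' _ _
    rw [p5] at p2 p4
    nlinarith
  have ht := (tendsto_pow_atTop_nhds_zero_of_lt_one h0.le h1).const_mul
    (lam + 2 * D * lam + 3 * D)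
  rw [mul_zero] at ht
  exact ge_of_tendsto' ht key

/-- A closed orbit shadowing the forward orbit of `x`, without self-approaches at scale `N`. -/
lemma exists_periodic_shadow {N : ℕ} (hN : 1 ≤ N) (x : SS Tr) {F : Finset ℕ}
    (hF : ∀ n, x.1 n ∈ F) :
    ∃ (i p : ℕ) (P : SS Tr), 1 ≤ p ∧ (shiftMap Tr)^[p] P = P ∧
      Agree (p + N) P ((shiftMap Tr)^[i] x) ∧
      ∀ s t, Agree N ((shiftMap Tr)^[s] P) ((shiftMap Tr)^[t] P) →
        (shiftMap Tr)^[s] P = (shiftMap Tr)^[t] P := by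
  classical
  have hex : ∃ p, 1 ≤ p ∧ ∃ i, Agree N ((shiftMap Tr)^[i + p] x) ((shiftMap Tr)^[i] x) := by
    obtain ⟨a, b, hab, he⟩ := Finite.exists_ne_map_eq_of_infinite
      (fun n : ℕ => fun j : Fin N => (⟨x.1 (n + j), hF _⟩ : F))
    wlog hlt : a < b generalizing a b
    · exact this b a hab.symm he.symm (by omega)
    refine ⟨b - a, by omega, a, fun j hj => ?_⟩
    rw [iterate_shiftMap_apply, iterate_shiftMap_apply, show a + (b - a) = b by omega]
    exact (congrArg Subtype.val (congrFun he ⟨j, hj⟩)).symm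
  obtain ⟨hp, i, hi⟩ := Nat.find_spec hex
  have hmin := fun q => Nat.find_min' hex (m := q)
  set p := Nat.find hex
  rw [add_comm, Function.iterate_add_apply] at hi
  set z := (shiftMap Tr)^[i] x with hz
  obtain ⟨P, hP, hPk⟩ := exists_periodize hp z (by
    have := hi 0 hN
    rwa [iterate_shiftMap_apply] at this)
  have hPz := hPk N hi
  refine ⟨i, p, P, hp, hP, hPz, ?_⟩
  have hmod : ∀ s, (shiftMap Tr)^[s] P = (shiftMap Tr)^[s % p] P := fun s =>
    (Function.IsPeriodicPt.iterate_mod_apply (f := shiftMap Tr) hP s).symm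
  have main : ∀ s t, s < t → t < p →
      ¬ Agree N ((shiftMap Tr)^[s] P) ((shiftMap Tr)^[t] P) := by
    intro s t hst htp hag
    have b1 : Agree N ((shiftMap Tr)^[s] P) ((shiftMap Tr)^[s] z) :=
      Agree.iterate (hPz.mono (by omega))
    have b2 : Agree N ((shiftMap Tr)^[t] P) ((shiftMap Tr)^[t] z) :=
      Agree.iterate (hPz.mono (by omega))
    have b3 := (b2.symm.trans hag.symm).trans b1
    rw [hz, ← Function.iterate_add_apply, ← Function.iterate_add_apply,
      show t + i = (s + i) + (t - s) by omega] at b3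
    have := hmin (t - s) ⟨by omega, s + i, b3⟩
    omega
  intro s t hst
  rw [hmod s, hmod t] at hst ⊢
  have hs := Nat.mod_lt s hp
  have ht := Nat.mod_lt t hp
  rcases lt_trichotomy (s % p) (t % p) with h | h | h
  · exact (main _ _ h ht hst).elim
  · rw [h]
  · exact (main _ _ h hs hst.symm).elim

open scoped Classical in
/-- The indicator of not starting with `N + 1` consecutive symbols of the orbit of `P`. -/
noncomputable def penalty (P : SS Tr) (N : ℕ) (y : SS Tr) : ℝ :=
  if ∃ s, Agree (N + 1) y ((shiftMap Tr)^[s] P) then 0 else 1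

lemma penalty_nonneg (P : SS Tr) (N : ℕ) (y : SS Tr) : 0 ≤ penalty P N y := by
  unfold penalty; split_ifs <;> norm_num

lemma penalty_le_one (P : SS Tr) (N : ℕ) (y : SS Tr) : penalty P N y ≤ 1 := by
  unfold penalty; split_ifs <;> norm_num

lemma penalty_eq_zero_iff {P : SS Tr} {N : ℕ} {y : SS Tr} :
    penalty P N y = 0 ↔ ∃ s, Agree (N + 1) y ((shiftMap Tr)^[s] P) := by
  unfold penalty; split_ifs with h <;> simp [h]

lemma penalty_eq_of_agree {P : SS Tr} {N : ℕ} {x y : SS Tr} (h : Agree (N + 1) x y) :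
    penalty P N x = penalty P N y := by
  have : (∃ s, Agree (N + 1) x ((shiftMap Tr)^[s] P)) ↔
      ∃ s, Agree (N + 1) y ((shiftMap Tr)^[s] P) :=
    exists_congr fun s => ⟨fun hs => h.symm.trans hs, fun hs => h.trans hs⟩
  unfold penalty
  by_cases hx : ∃ s, Agree (N + 1) x ((shiftMap Tr)^[s] P)
  · rw [if_pos hx, if_pos (this.1 hx)]
  · rw [if_neg hx, if_neg (mt this.2 hx)]

lemma penalty_sub_le_one (P : SS Tr) (N : ℕ) (x y : SS Tr) :
    penalty P N x - penalty P N y ≤ 1 := by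
  have := penalty_le_one P N x
  have := penalty_nonneg P N y
  linarith

lemma holderBound_mul_penalty (h0 : 0 < lam) (h1 : lam < 1) (P : SS Tr) (N : ℕ) {d : ℝ} (hd : 0 ≤ d) :
    HolderBound lam (fun y => d * penalty P N y) (d / lam ^ N) := by
  intro k x y _ hxy
  rcases Nat.lt_or_ge N k with hk | hk
  · simp only [penalty_eq_of_agree (P := P) (hxy.mono hk), sub_self]
    positivity
  · have e1 : 1 ≤ lam ^ k / lam ^ N := by
      rw [one_le_div (by positivity)]
      exact pow_le_pow_of_le_one h0.le h1.le hk
    calc d * penalty P N x - d * penalty P N y = d * (penalty P N x - penalty P N y) := by ring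
      _ ≤ d * (lam ^ k / lam ^ N) :=
        mul_le_mul_of_nonneg_left ((penalty_sub_le_one P N x y).trans e1) hd
      _ = d / lam ^ N * lam ^ k := by ring

section Shadowing

variable {P : SS Tr} {N p : ℕ}

lemma exists_agree_of_forall_agree
    (hinj : ∀ s t, Agree N ((shiftMap Tr)^[s] P) ((shiftMap Tr)^[t] P) →
      (shiftMap Tr)^[s] P = (shiftMap Tr)^[t] P) (L : ℕ) {y : SS Tr}
    (hy : ∀ i ≤ L, ∃ s, Agree (N + 1) ((shiftMap Tr)^[i] y) ((shiftMap Tr)^[s] P)) :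
    ∃ s, Agree (L + 1 + N) y ((shiftMap Tr)^[s] P) := by
  induction L generalizing y with
  | zero =>
    obtain ⟨s, hs⟩ := hy 0 le_rfl
    exact ⟨s, hs.mono (by omega)⟩
  | succ L ih =>
    obtain ⟨t, ht⟩ := ih (y := shiftMap Tr y) fun i hi => hy (i + 1) (by omega)
    obtain ⟨s, hs⟩ := hy 0 (by omega)
    have h2 : Agree N (shiftMap Tr y) ((shiftMap Tr)^[s + 1] P) := by
      rw [Function.iterate_succ_apply']
      exact Agree.shift hs
    have h3 := hinj _ _ ((ht.mono (by omega : N ≤ L + 1 + N)).symm.trans h2)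
    rw [h3, Function.iterate_succ_apply'] at ht
    refine ⟨s, fun i hi => ?_⟩
    rcases i with _ | i
    · exact hs 0 (by omega)
    · exact ht i (by omega)

lemma mem_orbit_of_forall_agree
    (hinj : ∀ s t, Agree N ((shiftMap Tr)^[s] P) ((shiftMap Tr)^[t] P) →
      (shiftMap Tr)^[s] P = (shiftMap Tr)^[t] P) {y : SS Tr}
    (hy : ∀ i, ∃ s, Agree (N + 1) ((shiftMap Tr)^[i] y) ((shiftMap Tr)^[s] P)) :
    ∃ s, y = (shiftMap Tr)^[s] P := by
  obtain ⟨s, hs⟩ := exists_agree_of_forall_agree hinj 0 fun i _ => hy i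
  refine ⟨s, ?_⟩
  ext i
  obtain ⟨t, ht⟩ := exists_agree_of_forall_agree hinj i fun i _ => hy i
  rw [hinj s t ((hs.mono (by omega)).symm.trans (ht.mono (by omega)))]
  exact ht i (by omega)

variable {R : SS Tr → ℝ} {r E d : ℝ}

lemma mul_sub_le_birk_of_periodic (hR : ∀ y, 0 ≤ R y) (hp : 1 ≤ p)
    (hP : (shiftMap Tr)^[p] P = P) (hr : 0 ≤ r) (hS : birk R p P = p * r) (L s : ℕ) :
    L * r - p * r ≤ birk R L ((shiftMap Tr)^[s] P) := by
  induction L using Nat.strong_induction_on with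
  | _ L ih =>
    rcases Nat.lt_or_ge L p with hL | hL
    · have e1 : (L : ℝ) ≤ p := by exact_mod_cast hL.le
      have := birk_nonneg hR L ((shiftMap Tr)^[s] P)
      nlinarith
    · obtain ⟨m, rfl⟩ := Nat.exists_eq_add_of_le hL
      have e1 := ih m (by omega)
      have e2 : birk R p ((shiftMap Tr)^[s] P) = p * r := by
        rw [← hS]; exact sum_range_iterate_of_periodic R hp hP s
      have e3 : (shiftMap Tr)^[p] ((shiftMap Tr)^[s] P) = (shiftMap Tr)^[s] P := by
        rw [← Function.iterate_add_apply, add_comm, Function.iterate_add_apply, hP]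
      rw [birk_add, e2, e3]
      push_cast
      linarith

/-- Birkhoff sums of `R + d * penalty` are, up to a constant, at least those of the constant `r`,
the mean of `R` over the orbit of `P`. -/
lemma mul_sub_le_birk_add_penalty (hR : ∀ y, 0 ≤ R y) (hp : 1 ≤ p)
    (hP : (shiftMap Tr)^[p] P = P) (hr : 0 ≤ r) (hS : birk R p P = p * r)
    (hinj : ∀ s t, Agree N ((shiftMap Tr)^[s] P) ((shiftMap Tr)^[t] P) →
      (shiftMap Tr)^[s] P = (shiftMap Tr)^[t] P)
    (hvar : ∀ n x y, Agree (n + N) x y → birk R n x - birk R n y ≤ E)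
    (hprE : p * r ≤ E) (hd : 3 * E ≤ d) (n : ℕ) (y : SS Tr) :
    n * r - 2 * E ≤ birk R n y + d * birk (penalty P N) n y := by
  have hp' : (1 : ℝ) ≤ p := by exact_mod_cast hp
  have hrE : r ≤ E := (le_mul_of_one_le_left hr hp').trans hprE
  have hd0 : 0 ≤ d := by linarith
  have stretch : ∀ (L : ℕ) (y : SS Tr), (∀ i < L, penalty P N ((shiftMap Tr)^[i] y) = 0) →
      L * r - 2 * E ≤ birk R L y := by
    intro L y hy
    rcases L with _ | L
    · simp only [birk_zero, Nat.cast_zero, zero_mul]; linarith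
    · obtain ⟨s, hs⟩ := exists_agree_of_forall_agree hinj L fun i hi =>
        penalty_eq_zero_iff.1 (hy i (by omega))
      have e1 := hvar _ _ _ hs.symm
      have e2 := mul_sub_le_birk_of_periodic hR hp hP hr hS (L + 1) s
      linarith
  induction n using Nat.strong_induction_on generalizing y with
  | _ n ih =>
    by_cases hall : ∀ i < n, penalty P N ((shiftMap Tr)^[i] y) = 0
    · have e1 := stretch n y hall
      have e2 := mul_nonneg hd0 (birk_nonneg (penalty_nonneg P N) n y)
      linarith
    · classical
      push Not at hall
      obtain ⟨L, hL, hlt⟩ : ∃ L, (L < n ∧ penalty P N ((shiftMap Tr)^[L] y) ≠ 0) ∧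
          ∀ i < L, ¬ (i < n ∧ penalty P N ((shiftMap Tr)^[i] y) ≠ 0) :=
        ⟨_, Nat.find_spec hall, fun i hi => Nat.find_min hall hi⟩
      obtain ⟨m, rfl⟩ : ∃ m, n = L + (1 + m) := ⟨n - L - 1, by omega⟩
      have e1 := stretch L y fun i hi => by
        by_contra hne
        exact hlt i hi ⟨by omega, hne⟩
      have e2 := ih m (by omega) ((shiftMap Tr)^[1] ((shiftMap Tr)^[L] y))
      have e3 : penalty P N ((shiftMap Tr)^[L] y) = 1 := by
        have := hL.2
        unfold penalty at this ⊢
        split_ifs at this ⊢ <;> simp_all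
      have e4 := hR ((shiftMap Tr)^[L] y)
      have e5 := mul_nonneg hd0 (birk_nonneg (penalty_nonneg P N) L y)
      rw [birk_add R, birk_add (penalty P N), birk_add R, birk_add (penalty P N), birk_one,
        birk_one, e3]
      push_cast
      nlinarith

end Shadowing

lemma measure_compl_msupport (μ : Measure (SS Tr)) : μ (msupport μ)ᶜ = 0 := by
  have : SecondCountableTopology (SS Tr) :=
    TopologicalSpace.Subtype.secondCountableTopology {x : ℕ → ℕ | ∀ n, Tr (x n) (x (n + 1))}
  refine measure_null_of_locally_null _ fun x hx => ?_
  simp only [msupport, mem_compl_iff, mem_ofPred_eq, not_forall, not_lt, nonpos_iff_eq_zero] at hx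
  obtain ⟨U, hU, hxU, h⟩ := hx
  exact ⟨U, mem_nhdsWithin_of_mem_nhds (hU.mem_nhds hxU), h⟩

section Integrals

variable {μ : Measure (SS Tr)}

lemma exists_ae_bound (hcpt : IsCompact (msupport μ)) {f : SS Tr → ℝ} (hf : Continuous f) :
    ∃ M, ∀ᵐ y ∂μ, |f y| ≤ M := by
  obtain ⟨M, hM⟩ := hcpt.exists_bound_of_continuousOn hf.continuousOn
  refine ⟨M, ?_⟩
  filter_upwards [mem_ae_iff.2 (measure_compl_msupport μ)] with y hy using hM y hy

lemma integrable_of_isCompact_msupport [IsFiniteMeasure μ] (hcpt : IsCompact (msupport μ))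
    {f : SS Tr → ℝ} (hf : Continuous f) : Integrable f μ := by
  obtain ⟨M, hM⟩ := exists_ae_bound hcpt hf
  exact Integrable.of_bound hf.aestronglyMeasurable M hM

lemma measurePreserving_shiftMap (hμ : μ.map (shiftMap Tr) = μ) :
    MeasurePreserving (shiftMap Tr) μ μ :=
  ⟨continuous_shiftMap.measurable, hμ⟩

lemma integral_le_of_birk_le [IsProbabilityMeasure μ] (hμ : μ.map (shiftMap Tr) = μ)
    (hcpt : IsCompact (msupport μ)) {f h : SS Tr → ℝ} (hf : Continuous f) (hh : Continuous h)
    {b c : ℝ} (hle : ∀ n y, birk f n y ≤ n * b + c + h ((shiftMap Tr)^[n] y) - h y) :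
    ∫ y, f y ∂μ ≤ b := by
  have hmp := measurePreserving_shiftMap hμ
  obtain ⟨M, hM⟩ := exists_ae_bound hcpt hh
  have hfi := integrable_of_isCompact_msupport hcpt hf
  have hint : ∀ i : ℕ, ∫ y, f ((shiftMap Tr)^[i] y) ∂μ = ∫ y, f y ∂μ := fun i => by
    have hi := hmp.iterate i
    conv_rhs => rw [← hi.map_eq]
    exact (integral_map hi.measurable.aemeasurable hf.aestronglyMeasurable).symm
  have hii : ∀ i : ℕ, Integrable (fun y => f ((shiftMap Tr)^[i] y)) μ := fun i =>
    (hmp.iterate i).integrable_comp_of_integrable hfi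
  have key : ∀ n : ℕ, (n : ℝ) * (∫ y, f y ∂μ - b) ≤ c + 2 * M := by
    intro n
    have e1 : ∫ y, birk f n y ∂μ = n * ∫ y, f y ∂μ := by
      simp only [birk]
      rw [integral_finsetSum _ fun i _ => hii i]
      simp [hint]
    have e2 : ∫ y, birk f n y ∂μ ≤ ∫ _, (n * b + c + 2 * M) ∂μ := by
      refine integral_mono_ae (integrable_finsetSum _ fun i _ => hii i) (integrable_const _) ?_
      filter_upwards [hM, (hmp.iterate n).quasiMeasurePreserving.ae hM] with y h1 h2
      have := hle n y
      have := (abs_le.1 h1).1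
      have := (abs_le.1 h2).2
      linarith
    rw [e1] at e2
    simp only [integral_const, probReal_univ, one_smul] at e2
    linarith
  by_contra! hlt
  obtain ⟨n, hn⟩ := exists_nat_gt ((c + 2 * M) / (∫ y, f y ∂μ - b))
  rw [div_lt_iff₀ (by linarith)] at hn
  exact absurd (key n) (by linarith)

lemma eq_orbitMeasure_of_ae_mem_orbit [IsProbabilityMeasure μ] (hμ : μ.map (shiftMap Tr) = μ)
    {p : ℕ} (hp : 1 ≤ p) {P : SS Tr} (hP : (shiftMap Tr)^[p] P = P)
    (hae : ∀ᵐ y ∂μ, ∃ s, y = (shiftMap Tr)^[s] P) : μ = orbitMeasure p P := by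
  have hmp := measurePreserving_shiftMap hμ
  ext S hS
  rw [orbitMeasure_apply _ _ hS]
  have e1 : ∫⁻ y, ∑ i ∈ Finset.range p, S.indicator (1 : SS Tr → ℝ≥0∞) ((shiftMap Tr)^[i] y) ∂μ
      = p * μ S := by
    rw [lintegral_finsetSum (f := fun i y => S.indicator (1 : SS Tr → ℝ≥0∞) ((shiftMap Tr)^[i] y)) _
      fun i _ => (measurable_one.indicator hS).comp (hmp.iterate i).measurable]
    have : ∀ i : ℕ, ∫⁻ y, S.indicator (1 : SS Tr → ℝ≥0∞) ((shiftMap Tr)^[i] y) ∂μ = μ S :=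
      fun i => by
        rw [(hmp.iterate i).lintegral_comp (measurable_one.indicator hS), lintegral_indicator_one hS]
    simp [this]
  have e2 : ∫⁻ y, ∑ i ∈ Finset.range p, S.indicator (1 : SS Tr → ℝ≥0∞) ((shiftMap Tr)^[i] y) ∂μ
      = ∑ i ∈ Finset.range p, S.indicator (1 : SS Tr → ℝ≥0∞) ((shiftMap Tr)^[i] P) := by
    rw [lintegral_congr_ae (g := fun _ =>
      ∑ i ∈ Finset.range p, S.indicator (1 : SS Tr → ℝ≥0∞) ((shiftMap Tr)^[i] P))]
    · simp
    · filter_upwards [hae] with y hy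
      obtain ⟨s, rfl⟩ := hy
      exact sum_range_iterate_of_periodic _ hp hP s
  rw [← e2, e1, ← mul_assoc, ENNReal.inv_mul_cancel (by simp; omega) (by simp), one_mul]

end Integrals

lemma svDist_sub_penalty_le (h0 : 0 < lam) (h1 : lam < 1) (A : SS Tr → ℝ) (P : SS Tr) (N : ℕ)
    {d : ℝ} (hd : 0 ≤ d) :
    svDist lam A (fun y => A y - d * penalty P N y) ≤ ENNReal.ofReal ((N + 1) * d) := by
  unfold svDist
  have hs : (fun y => A y - (A y - d * penalty P N y)) = fun y => d * penalty P N y := by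
    ext y; ring
  have hv : ∀ k, varAt lam (fun y => d * penalty P N y) (1 + k) ≤
      if k < N then ENNReal.ofReal d else 0 := by
    intro k
    split_ifs with hk
    · rw [varAt_le_iff h0 h1 hd]
      intro x y _
      have := mul_le_mul_of_nonneg_left (penalty_sub_le_one P N x y) hd
      linarith
    · rw [← ENNReal.ofReal_zero, varAt_le_iff h0 h1 le_rfl]
      intro x y hxy
      rw [penalty_eq_of_agree (hxy.mono (by omega)), sub_self]
  have e1 : varFrom lam (fun y => A y - (A y - d * penalty P N y)) 1 ≤ ENNReal.ofReal (N * d) := by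
    rw [hs, varFrom]
    refine (ENNReal.tsum_le_tsum hv).trans ?_
    rw [tsum_eq_sum (s := Finset.range N) fun k hk => if_neg (by simpa using hk),
      Finset.sum_congr rfl fun k hk => if_pos (Finset.mem_range.1 hk)]
    simp [ENNReal.ofReal_mul]
  have e2 : ⨆ y, ENNReal.ofReal |A y - (A y - d * penalty P N y)| ≤ ENNReal.ofReal d := by
    refine iSup_le fun y => ENNReal.ofReal_le_ofReal ?_
    rw [congrFun hs y, abs_of_nonneg (mul_nonneg hd (penalty_nonneg P N y))]
    exact mul_le_of_le_one_right hd (penalty_le_one P N y)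
  refine (add_le_add e1 e2).trans ?_
  rw [← ENNReal.ofReal_add (by positivity) hd, add_mul, one_mul]

lemma exists_pow_mul_le (h0 : 0 < lam) (h1 : lam < 1) (D : ℝ) {e : ℝ} (he : 0 < e) :
    ∃ N : ℕ, 1 ≤ N ∧ D * lam ^ N ≤ e / (N + 2) := by
  have ht : Tendsto (fun N : ℕ => D * ((N : ℝ) * lam ^ N + 2 * lam ^ N)) atTop (nhds 0) := by
    simpa using ((tendsto_self_mul_const_pow_of_lt_one h0.le h1).add
      ((tendsto_pow_atTop_nhds_zero_of_lt_one h0.le h1).const_mul 2)).const_mul D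
  obtain ⟨N, hN, hN1⟩ := ((ht.eventually_lt_const he).and (eventually_ge_atTop 1)).exists
  refine ⟨N, hN1, ?_⟩
  rw [le_div_iff₀ (by positivity)]
  linarith

end

theorem dense_periodic_optimization
    (lam : ℝ) (hlam0 : 0 < lam) (hlam1 : lam < 1)
    (Tr : ℕ → ℕ → Prop) (htr : TopTransitive Tr)
    (A : SS Tr → ℝ) (hA : IsPotential A) (hAh : LocHolder lam A)
    (K : Set (SS Tr)) (hKne : K.Nonempty) (hKcpt : IsCompact K)
    (hKinv : shiftMap Tr '' K ⊆ K) (hKAub : K ⊆ Aubry lam A)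
    (hKfin : ∃ F : Finset ℕ, ∀ x ∈ K, ∀ n : ℕ, x.1 n ∈ F)
    (ε : ℝ) (hε : 0 < ε) :
    ∃ B : SS Tr → ℝ, IsPotential B ∧ LocHolder lam B ∧
      svDist lam A B < ENNReal.ofReal ε ∧
      ∃ ν : Measure (SS Tr), PeriodicOrbitMeasure ν ∧
        ∀ μ : Measure (SS Tr), Maximizing B μ → IsCompact (msupport μ) → μ = ν := by
  obtain ⟨C, hC, hAC⟩ := hAh.exists_holderBound hlam0 hlam1
  obtain ⟨x, hx⟩ := hKne
  obtain ⟨F, hF⟩ := hKfin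
  obtain ⟨h, hsub, hh⟩ := exists_subaction hlam0 hlam1 htr hA.2 hC hAC x
  set D := C / (1 - lam) with hD
  have hD0 : 0 < D := div_pos hC (by linarith)
  set R := defect A h (beta A) with hRdef
  have hR : ∀ y, 0 ≤ R y := fun y => by
    have := hsub y
    simp only [hRdef, defect]
    linarith
  have hmem : ∀ i : ℕ, (shiftMap Tr)^[i] x ∈ K := fun i =>
    (show MapsTo (shiftMap Tr) K K from fun y hy => hKinv ⟨y, hy, rfl⟩).iterate i hx
  have hRK : ∀ i : ℕ, R ((shiftMap Tr)^[i] x) = 0 := fun i =>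
    defect_eq_zero_of_mem_aubry hlam0 hlam1 hC hAC hh hR (hKAub (hmem i))
  obtain ⟨N, hN, hNε⟩ := exists_pow_mul_le hlam0 hlam1 (18 * D) hε
  obtain ⟨i, p, P, hp, hP, hPx, hinj⟩ := exists_periodic_shadow hN x (hF x hx)
  have hp0 : (0 : ℝ) < p := by exact_mod_cast hp
  set E := 3 * (D * lam ^ N) with hE
  have hvar : ∀ n y z, Agree (n + N) y z → birk R n y - birk R n z ≤ E := fun n y z hyz =>
    birk_defect_sub_le hlam0 hlam1 hC hAC hh (beta A) hN hyz
  set r := birk R p P / p with hr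
  have hS : birk R p P = p * r := by rw [hr]; field_simp
  have hr0 : 0 ≤ r := div_nonneg (birk_nonneg hR p P) hp0.le
  have hprE : p * r ≤ E := by
    have e1 := hvar p _ _ hPx
    have e2 : birk R p ((shiftMap Tr)^[i] x) = 0 := by
      refine Finset.sum_eq_zero fun j _ => ?_
      rw [← Function.iterate_add_apply]
      exact hRK _
    linarith
  set d := ε / (N + 2) / 2 with hd
  have hd0 : 0 < d := by positivity
  have hEd : 3 * E ≤ d := by rw [hE, hd]; linarith
  have hlow := mul_sub_le_birk_add_penalty hR hp hP hr0 hS hinj hvar hprE hEd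
  have hpen : HolderBound lam (fun y => d * penalty P N y) (d / lam ^ N) :=
    holderBound_mul_penalty hlam0 hlam1 P N hd0.le
  have hpenc : Continuous fun y => d * penalty P N y := hpen.continuous hlam0 hlam1
  set B : SS Tr → ℝ := fun y => A y - 2 * d * penalty P N y with hB
  have hBc : Continuous B := by
    have : B = fun y => A y - 2 * (d * penalty P N y) := by ext y; simp only [hB]; ring
    rw [this]
    exact hA.1.sub (continuous_const.mul hpenc)
  have hBbdd : BddAbove (range B) := by
    obtain ⟨M, hM⟩ := hA.2
    refine ⟨M, ?_⟩
    rintro _ ⟨y, rfl⟩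
    have e1 := hM (mem_range_self y)
    have e2 := mul_nonneg hd0.le (penalty_nonneg P N y)
    simp only [hB]
    linarith
  have hBH : HolderBound lam B (C + 2 * d / lam ^ N) := by
    intro k y z hk hyz
    have e1 := hAC k y z hk hyz
    have e2 := holderBound_mul_penalty hlam0 hlam1 P N (d := 2 * d) (by positivity) k z y hk hyz.symm
    simp only [hB]
    linarith
  have hbirkB : ∀ n y, birk B n y = birk A n y - 2 * d * birk (penalty P N) n y := fun n y => by
    simp only [birk, hB, Finset.sum_sub_distrib, Finset.mul_sum]
  have hPpen : ∀ s : ℕ, penalty P N ((shiftMap Tr)^[s] P) = 0 := fun s =>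
    penalty_eq_zero_iff.2 ⟨s, fun _ _ => rfl⟩
  have hbeta : beta A - r ≤ beta B := by
    have e1 := inv_mul_birk_le_beta hBbdd hp hP
    have e2 : birk (penalty P N) p P = 0 := Finset.sum_eq_zero fun j _ => hPpen j
    have e3 : birk R p P = p * beta A - birk A p P + h ((shiftMap Tr)^[p] P) - h P :=
      birk_defect A h (beta A) p P
    rw [hP] at e3
    have e4 : birk B p P = p * (beta A - r) := by rw [hbirkB, e2]; linarith
    rwa [e4, inv_mul_cancel_left₀ hp0.ne'] at e1
  refine ⟨B, ⟨hBc, hBbdd⟩, hBH.locHolder hlam0 hlam1 (by positivity), ?_, orbitMeasure p P,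
    ⟨P, p, hp, hP, rfl⟩, ?_⟩
  · refine (svDist_sub_penalty_le hlam0 hlam1 A P N (by positivity)).trans_lt ?_
    rw [ENNReal.ofReal_lt_ofReal_iff hε, hd,
      show (N + 1 : ℝ) * (2 * (ε / (N + 2) / 2)) = (N + 1) * ε / (N + 2) by ring,
      div_lt_iff₀ (by positivity)]
    linarith
  · rintro μ ⟨hprob, hinv, hmax⟩ hcpt
    have hBi := integrable_of_isCompact_msupport hcpt hBc
    have hpi := integrable_of_isCompact_msupport hcpt hpenc
    have hle : ∫ y, (B y + d * penalty P N y) ∂μ ≤ beta A - r := by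
      refine integral_le_of_birk_le hinv hcpt (hBc.add hpenc) (hh.continuous hlam0 hlam1)
        (f := fun y => B y + d * penalty P N y) (c := 2 * E) fun n y => ?_
      have e1 : birk (fun y => B y + d * penalty P N y) n y =
          birk B n y + d * birk (penalty P N) n y := by
        simp only [birk, Finset.sum_add_distrib, Finset.mul_sum]
      have e2 : birk R n y = n * beta A - birk A n y + h ((shiftMap Tr)^[n] y) - h y :=
        birk_defect A h (beta A) n y
      have e3 := hlow n y
      rw [e1, hbirkB]
      linarith
    rw [integral_add hBi hpi, hmax] at hle
    have hpn : ∀ y, 0 ≤ d * penalty P N y := fun y => mul_nonneg hd0.le (penalty_nonneg P N y)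
    have hz : ∫ y, d * penalty P N y ∂μ = 0 :=
      le_antisymm (by linarith) (integral_nonneg hpn)
    rw [integral_eq_zero_iff_of_nonneg hpn hpi] at hz
    have hmp := measurePreserving_shiftMap hinv
    refine eq_orbitMeasure_of_ae_mem_orbit hinv hp hP ?_
    have hall : ∀ᵐ y ∂μ, ∀ j : ℕ, d * penalty P N ((shiftMap Tr)^[j] y) = 0 :=
      ae_all_iff.2 fun j => (hmp.iterate j).quasiMeasurePreserving.ae hz
    filter_upwards [hall] with y hy
    exact mem_orbit_of_forall_agree hinj fun j =>
      penalty_eq_zero_iff.1 ((mul_eq_zero.1 (hy j)).resolve_left hd0.ne')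

end CMS
end

section
/- Let A : Σ → ℝ be a potential. Then the Aubry set Ω(A) is forward invariant under the shift: σ(Ω(A)) ⊆ Ω(A). -/
open MeasureTheory Filter Set
open scoped ENNReal

namespace CMS

theorem eq_of_sdist_lt_pow {lam : ℝ} (hlam0 : 0 < lam) (hlam1 : lam < 1) {Tr : ℕ → ℕ → Prop}
    {x y : SS Tr} {k : ℕ} (h : sdist lam x y < lam ^ k) {i : ℕ} (hi : i ≤ k) :
    x.1 i = y.1 i := by
  classical
  by_contra hne
  have hex : ∃ n, x.1 n ≠ y.1 n := ⟨i, hne⟩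
  rw [sdist, dif_pos hex] at h
  refine absurd h (not_lt.2 (pow_le_pow_of_le_one hlam0.le hlam1.le ?_))
  exact (Nat.find_min' hex hne).trans hi

theorem sdist_le_pow {lam : ℝ} (hlam0 : 0 < lam) (hlam1 : lam < 1) {Tr : ℕ → ℕ → Prop}
    {x y : SS Tr} {k : ℕ} (h : ∀ i < k, x.1 i = y.1 i) : sdist lam x y ≤ lam ^ k := by
  classical
  rw [sdist]
  split_ifs with hex
  · refine pow_le_pow_of_le_one hlam0.le hlam1.le ?_
    by_contra! hlt
    exact Nat.find_spec hex (h _ hlt)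
  · positivity

theorem sdist_shiftMap_le_pow {lam : ℝ} (hlam0 : 0 < lam) (hlam1 : lam < 1)
    {Tr : ℕ → ℕ → Prop} {x y : SS Tr} {k : ℕ} (h : sdist lam x y < lam ^ k) :
    sdist lam (shiftMap Tr x) (shiftMap Tr y) ≤ lam ^ k :=
  sdist_le_pow hlam0 hlam1 fun _ hi => eq_of_sdist_lt_pow hlam0 hlam1 h hi

/-- A continuous function on `Σ` is almost constant on small cylinders. -/
theorem exists_forall_agree_abs_sub_lt {Tr : ℕ → ℕ → Prop} {A : SS Tr → ℝ} (hA : Continuous A)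
    (x : SS Tr) {δ : ℝ} (hδ : 0 < δ) :
    ∃ k : ℕ, ∀ y : SS Tr, (∀ i ≤ k, y.1 i = x.1 i) → |A y - A x| < δ := by
  by_contra! hcon
  choose y hy hAy using hcon
  have hlim : Tendsto y atTop (nhds x) := by
    rw [tendsto_subtype_rng, tendsto_pi_nhds]
    intro i
    refine tendsto_const_nhds.congr' ?_
    filter_upwards [eventually_ge_atTop i] with k hk using (hy k i hk).symm
  obtain ⟨k, hk⟩ :=
    (Metric.tendsto_nhds.1 ((hA.tendsto x).comp hlim) δ hδ).exists
  exact absurd hk (not_lt.2 (hAy k))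

theorem birk_shiftMap {Tr : ℕ → ℕ → Prop} (f : SS Tr → ℝ) (n : ℕ) (x : SS Tr) :
    birk f n (shiftMap Tr x) = birk f n x + f ((shiftMap Tr)^[n] x) - f x := by
  have h := (Finset.sum_range_succ (fun i => f ((shiftMap Tr)^[i] x)) n).symm.trans
    (Finset.sum_range_succ' (fun i => f ((shiftMap Tr)^[i] x)) n)
  simp only [Function.iterate_succ_apply, Function.iterate_zero_apply] at h
  simp only [birk]
  linarith

theorem aubry_forward_invariant
    (lam : ℝ) (hlam0 : 0 < lam) (hlam1 : lam < 1)
    (Tr : ℕ → ℕ → Prop)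
    (A : SS Tr → ℝ) (hA : IsPotential A) :
    shiftMap Tr '' Aubry lam A ⊆ Aubry lam A := by
  rintro _ ⟨x, hx, rfl⟩ ε hε
  obtain ⟨k, hk⟩ := exists_forall_agree_abs_sub_lt hA.1 x (show 0 < ε / 4 by positivity)
  obtain ⟨m, hm⟩ := exists_pow_lt_of_lt_one hε hlam1
  have hpow : 0 < lam ^ max k m := by positivity
  have hpow_lt : lam ^ max k m < ε :=
    (pow_le_pow_of_le_one hlam0.le hlam1.le (le_max_right k m)).trans_lt hm
  obtain ⟨w, n, hn, hxw, hwx, hlow, hup⟩ :=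
    hx (min (lam ^ max k m) (ε / 2)) (lt_min hpow (by positivity))
  have hxw' := hxw.trans_le (min_le_left _ _)
  have hwx' := hwx.trans_le (min_le_left _ _)
  have hAw := abs_lt.1 (hk w fun i hi =>
    (eq_of_sdist_lt_pow hlam0 hlam1 hxw' (hi.trans (le_max_left k m))).symm)
  have hAnw := abs_lt.1 (hk _ fun i hi =>
    eq_of_sdist_lt_pow hlam0 hlam1 hwx' (hi.trans (le_max_left k m)))
  have hmin := min_le_right (lam ^ max k m) (ε / 2)
  refine ⟨shiftMap Tr w, n, hn, (sdist_shiftMap_le_pow hlam0 hlam1 hxw').trans_lt hpow_lt,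
    ?_, ?_, ?_⟩
  · rw [← Function.iterate_succ_apply, Function.iterate_succ_apply']
    exact (sdist_shiftMap_le_pow hlam0 hlam1 hwx').trans_lt hpow_lt
  · rw [birk_shiftMap]
    linarith [hAw.1, hAw.2, hAnw.1, hAnw.2]
  · rw [birk_shiftMap]
    linarith [hAw.1, hAw.2, hAnw.1, hAnw.2]

end CMS
end
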